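/- arXiv:2202.05380 — 8 statements merged into one kernel-verified Lean document; each statement's English description precedes it below -/
import Mathlib

section
/- Let X be an n-premaniplex, Y an m-premaniplex, and let η : {0,…,m−1} × Y → W_n satisfy (i) η(i, r_i·y) = η(i, y)⁻¹ for all i and y, and (ii) η(i, r_j r_i r_j·y) · η(j, r_i r_j·y) · η(i, r_j·y) · η(j, y) = 1 for all y whenever |i − j| ≥ 2. Then there is a unique left action of W_m on X × Y such that r_i·(x, y) = (η(i, y)·x, r_i·y) for all i, x, y; moreover this action has the form w·(x, y) = (σ(w, y)·x, w·y) for a unique voltage cocycle σ : W_m × Y → W_n with σ(r_i, y) = η(i, y). In particular X × Y with this action is an m-premaniplex (denoted X ⋊_σ Y). -/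
/-- The defining relations of the universal string Coxeter group of rank `n`:
`rᵢ² = 1` for all `i`, and `(rᵢ rⱼ)² = 1` whenever `|i - j| ≥ 2`. -/
def maniRels (n : ℕ) : Set (FreeGroup (Fin n)) :=
  {w | (∃ i : Fin n, w = FreeGroup.of i * FreeGroup.of i) ∨
    (∃ i j : Fin n, 2 ≤ |(i : ℤ) - (j : ℤ)| ∧
      w = FreeGroup.of i * FreeGroup.of j * (FreeGroup.of i * FreeGroup.of j))}

/-- The universal string Coxeter group `W n` of rank `n`. -/
abbrev W (n : ℕ) := PresentedGroup (maniRels n)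

/-- The distinguished involutory generators `r i` of `W n`. -/
def r {n : ℕ} (i : Fin n) : W n := PresentedGroup.of i

/-- `σ : G → A → H` is a voltage cocycle with respect to the action `act` of `G` on `A`:
`σ 1 a = 1` and `σ (v * w) a = σ v (w · a) * σ w a`. -/
def IsVoltage {G H A : Type*} [Monoid G] [Monoid H]
    (act : G → A → A) (σ : G → A → H) : Prop :=
  (∀ a : A, σ 1 a = 1) ∧ ∀ v w : G, ∀ a : A, σ (v * w) a = σ v (act w a) * σ w a

/-- The voltage-operation action on `A × B`: `g · (a, b) = (σ g b · a, g · b)`. -/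
def vAct {G H A B : Type*} (actA : H → A → A) (actB : G → B → B)
    (σ : G → B → H) (g : G) (p : A × B) : A × B :=
  (actA (σ g p.2) p.1, actB g p.2)

/-- The derived-premaniplex action on `B × Γ`: `g · (b, γ) = (g · b, ξ g b * γ)`. -/
def dAct {G Γ B : Type*} [Mul Γ] (actB : G → B → B) (ξ : G → B → Γ)
    (g : G) (p : B × Γ) : B × Γ :=
  (actB g p.1, ξ g p.1 * p.2)

/-- The scalar action, as a bare function. -/
def smulF (G A : Type*) [SMul G A] : G → A → A := fun g a => g • a

theorem r_mul_self {m : ℕ} (i : Fin m) : (r i * r i : W m) = 1 :=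
  PresentedGroup.one_of_mem (rels := maniRels m) (Or.inl ⟨i, rfl⟩)

theorem r_inv {m : ℕ} (i : Fin m) : (r i : W m)⁻¹ = r i :=
  inv_eq_of_mul_eq_one_left (r_mul_self i)

theorem r_mul_r_sq {m : ℕ} {i j : Fin m} (h : 2 ≤ |(i : ℤ) - (j : ℤ)|) :
    (r i * r j * (r i * r j) : W m) = 1 :=
  PresentedGroup.one_of_mem (rels := maniRels m) (Or.inr ⟨i, j, h, rfl⟩)

/-- Induction on `W m` by left multiplication with the generators. -/
theorem W_induction {m : ℕ} {P : W m → Prop} (one : P 1)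
    (mul : ∀ i w, P w → P (r i * w)) (w : W m) : P w := by
  have hw : w ∈ Subgroup.closure (Set.range (PresentedGroup.of (rels := maniRels m))) := by
    simp
  induction hw using Subgroup.closure_induction_left with
  | one => exact one
  | mul_left x hx y _ ih =>
    obtain ⟨i, rfl⟩ := hx
    exact mul i y ih
  | inv_mul_cancel x hx y _ ih =>
    obtain ⟨i, rfl⟩ := hx
    have h := mul i y ih
    rwa [← r_inv i] at h

/-- A voltage cocycle on `W m` is determined by its values on the generators. -/
theorem IsVoltage.ext_r {m : ℕ} {H Y : Type*} [Monoid H] [MulAction (W m) Y]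
    {σ τ : W m → Y → H} (hσ : IsVoltage (smulF (W m) Y) σ) (hτ : IsVoltage (smulF (W m) Y) τ)
    (h : ∀ i y, σ (r i) y = τ (r i) y) : σ = τ := by
  funext w
  induction w using W_induction with
  | one => funext y; rw [hσ.1, hτ.1]
  | mul i w ih => funext y; rw [hσ.2, hτ.2, h, ih]

/-- An assignment of voltages to the darts of `Y` that is trivial on the closed paths coming from
the defining relations extends to a voltage cocycle. -/
theorem exists_isVoltage {m : ℕ} {H Y : Type*} [Group H] [MulAction (W m) Y]
    (η : Fin m → Y → H)
    (h1 : ∀ (i : Fin m) (y : Y), η i (r i • y) = (η i y)⁻¹)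
    (h2 : ∀ i j : Fin m, 2 ≤ |(i : ℤ) - (j : ℤ)| → ∀ y : Y,
      η i ((r j * r i * r j : W m) • y) * η j ((r i * r j : W m) • y) *
        η i ((r j : W m) • y) * η j y = 1) :
    ∃ σ : W m → Y → H, IsVoltage (smulF (W m) Y) σ ∧ ∀ i y, σ (r i) y = η i y := by
  have hinv : ∀ i, Function.Involutive
      (fun p : H × Y => (η i p.2 * p.1, (r i : W m) • p.2)) := by
    rintro i ⟨g, y⟩
    simp [h1, smul_smul, r_mul_self]
  let f : Fin m → Equiv.Perm (H × Y) := fun i => (hinv i).toPerm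
  have hf : ∀ i g y, f i (g, y) = (η i y * g, (r i : W m) • y) := fun _ _ _ => rfl
  have hrels : ∀ w ∈ maniRels m, FreeGroup.lift f w = 1 := by
    rintro w (⟨i, rfl⟩ | ⟨i, j, hij, rfl⟩)
    · ext1 p
      simp only [map_mul, FreeGroup.lift_apply_of]
      exact hinv i p
    · ext1 ⟨g, y⟩
      have h := h2 i j hij y
      have hr := congrArg (· • y) (r_mul_r_sq hij)
      simp only [mul_smul, one_smul] at h hr
      simp only [map_mul, FreeGroup.lift_apply_of, Equiv.Perm.mul_apply, hf, hr,
        Equiv.Perm.one_apply, ← mul_assoc, h, one_mul]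
  let φ : W m →* Equiv.Perm (H × Y) := PresentedGroup.toGroup hrels
  have hφr : ∀ i, φ (r i) = f i := fun i => PresentedGroup.toGroup.of hrels
  have hφ : ∀ w g y, φ w (g, y) = ((φ w (1, y)).1 * g, w • y) := by
    intro w
    induction w using W_induction with
    | one => simp
    | mul i w ih =>
      intro g y
      simp only [map_mul, Equiv.Perm.mul_apply, hφr]
      rw [ih g y, ih 1 y]
      simp [hf, mul_smul, mul_assoc]
  refine ⟨fun w y => (φ w (1, y)).1, ⟨fun y => by simp, fun v w y => ?_⟩, fun i y => ?_⟩
  · simp only [map_mul, Equiv.Perm.mul_apply]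
    rw [hφ w 1 y, hφ v]
    simp [smulF]
  · simp [hφr, hf]

/-- Given an `n`-premaniplex `X`, an `m`-premaniplex `Y`, and
`η : Fin m × Y → W n` satisfying (i) `η i (rᵢ·y) = (η i y)⁻¹` and (ii) the length-4
alternating-path condition for `|i - j| ≥ 2`, there is a unique left action of `W m` on
`X × Y` with `rᵢ · (x, y) = (η i y · x, rᵢ · y)`; moreover any such action has the form
`w · (x, y) = (σ w y · x, w · y)` for a unique voltage cocycle `σ` with `σ (rᵢ) y = η i y`.
In particular `X × Y` with this action is an `m`-premaniplex, denoted `X ⋊_σ Y`. -/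
theorem statement0 {n m : ℕ} (X Y : Type*) [MulAction (W n) X] [MulAction (W m) Y]
    (η : Fin m → Y → W n)
    (h1 : ∀ (i : Fin m) (y : Y), η i (r i • y) = (η i y)⁻¹)
    (h2 : ∀ i j : Fin m, 2 ≤ |(i : ℤ) - (j : ℤ)| → ∀ y : Y,
      η i ((r j * r i * r j : W m) • y) * η j ((r i * r j : W m) • y) *
        η i ((r j : W m) • y) * η j y = 1) :
    (∃! μ : W m → X × Y → X × Y,
      (∀ p : X × Y, μ 1 p = p) ∧
      (∀ (v w : W m) (p : X × Y), μ (v * w) p = μ v (μ w p)) ∧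
      ∀ (i : Fin m) (x : X) (y : Y), μ (r i) (x, y) = (η i y • x, r i • y)) ∧
    ∀ μ : W m → X × Y → X × Y,
      ((∀ p : X × Y, μ 1 p = p) ∧
        (∀ (v w : W m) (p : X × Y), μ (v * w) p = μ v (μ w p)) ∧
        ∀ (i : Fin m) (x : X) (y : Y), μ (r i) (x, y) = (η i y • x, r i • y)) →
      ∃! σ : W m → Y → W n,
        IsVoltage (smulF (W m) Y) σ ∧
        (∀ (i : Fin m) (y : Y), σ (r i) y = η i y) ∧
        ∀ (w : W m) (x : X) (y : Y), μ w (x, y) = (σ w y • x, w • y) := by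
  obtain ⟨σ, hσ, hση⟩ := exists_isVoltage η h1 h2
  have key : ∀ μ : W m → X × Y → X × Y,
      ((∀ p : X × Y, μ 1 p = p) ∧
        (∀ (v w : W m) (p : X × Y), μ (v * w) p = μ v (μ w p)) ∧
        ∀ (i : Fin m) (x : X) (y : Y), μ (r i) (x, y) = (η i y • x, r i • y)) →
      ∀ (w : W m) (x : X) (y : Y), μ w (x, y) = (σ w y • x, w • y) := by
    rintro μ ⟨hone, hmul, hr⟩ w
    induction w using W_induction with
    | one => simp [hone, hσ.1]
    | mul i w ih =>
      intro x y
      rw [hmul, ih, hr, hσ.2, hση, mul_smul, mul_smul, smulF]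
  refine ⟨⟨vAct (smulF (W n) X) (smulF (W m) Y) σ, ⟨?_, ?_, ?_⟩, ?_⟩, ?_⟩
  · simp [vAct, smulF, hσ.1]
  · simp [vAct, hσ.2, smulF, mul_smul]
  · simp [vAct, smulF, hση]
  · intro μ hμ
    funext w ⟨x, y⟩
    exact key μ hμ w x y
  · intro μ hμ
    refine ⟨σ, ⟨hσ, hση, key μ hμ⟩, ?_⟩
    rintro τ ⟨hτ, hτη, -⟩
    exact hτ.ext_r hσ fun i y => by rw [hτη, hση]
end

section
/- Let X be a nonempty n-premaniplex, (Y, σ) an (n,m)-voltage operator, and y₀ ∈ Y. Then the W_m-action on X ⋊_σ Y is transitive if and only if the W_m-action on Y is transitive and the set H(y₀) = { σ(w, y₀) : w ∈ W_m, w·y₀ = y₀ } (which is a subgroup of W_n) acts transitively on X. -/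
/-- The voltages of the elements fixing a base point form a subgroup. -/
def voltageSubgroup {G H A : Type*} [Group G] [Group H] [MulAction G A]
    (σ : G → A → H) (hσ : IsVoltage (smulF G A) σ) (a : A) : Subgroup H where
  carrier := {h | ∃ g : G, g • a = a ∧ σ g a = h}
  one_mem' := ⟨1, one_smul G a, hσ.1 a⟩
  mul_mem' := by
    rintro _ _ ⟨v, hv, rfl⟩ ⟨w, hw, rfl⟩
    refine ⟨v * w, by rw [mul_smul, hw, hv], ?_⟩
    rw [hσ.2, smulF, hw]
  inv_mem' := by
    rintro _ ⟨w, hw, rfl⟩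
    have hw' : w⁻¹ • a = a := inv_smul_eq_iff.mpr hw.symm
    refine ⟨w⁻¹, hw', eq_inv_of_mul_eq_one_left ?_⟩
    have h := hσ.2 w⁻¹ w a
    rwa [inv_mul_cancel, hσ.1, smulF, hw, eq_comm] at h

/-- For nonempty `X`, the `W m`-action on `X ⋊_σ Y` is transitive iff
the `W m`-action on `Y` is transitive and the set `H(y₀) = {σ w y₀ : w · y₀ = y₀}`
(which is a subgroup of `W n`) acts transitively on `X`. -/
theorem statement3 {n m : ℕ} (X Y : Type*) [Nonempty X]
    [MulAction (W n) X] [MulAction (W m) Y]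
    (σ : W m → Y → W n) (hσ : IsVoltage (smulF (W m) Y) σ) (y₀ : Y) :
    (∃ H : Subgroup (W n),
      (H : Set (W n)) = {g : W n | ∃ w : W m, w • y₀ = y₀ ∧ σ w y₀ = g}) ∧
    ((∀ p q : X × Y, ∃ w : W m, vAct (smulF (W n) X) (smulF (W m) Y) σ w p = q) ↔
      ((∀ y y' : Y, ∃ w : W m, w • y = y') ∧
        ∀ x x' : X, ∃ g : W n,
          (∃ w : W m, w • y₀ = y₀ ∧ σ w y₀ = g) ∧ g • x = x')) := by
  refine ⟨⟨voltageSubgroup σ hσ y₀, rfl⟩, ?_, ?_⟩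
  · intro h
    refine ⟨fun y y' => ?_, fun x x' => ?_⟩
    · obtain ⟨x⟩ := ‹Nonempty X›
      obtain ⟨w, hw⟩ := h (x, y) (x, y')
      exact ⟨w, congrArg Prod.snd hw⟩
    · obtain ⟨w, hw⟩ := h (x, y₀) (x', y₀)
      exact ⟨σ w y₀, ⟨w, congrArg Prod.snd hw, rfl⟩, congrArg Prod.fst hw⟩
  · rintro ⟨hY, hX⟩ ⟨x, y⟩ ⟨x', y'⟩
    obtain ⟨u, hu⟩ := hY y y₀
    obtain ⟨v, hv⟩ := hY y₀ y'
    obtain ⟨_, ⟨w, hw, rfl⟩, hx⟩ := hX (σ u y • x) ((σ v y₀)⁻¹ • x')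
    refine ⟨v * (w * u), Prod.ext ?_ ?_⟩
    · simp only [vAct, smulF, hσ.2, mul_smul, hu, hw, hx, smul_inv_smul]
    · simp only [vAct, smulF, mul_smul, hu, hw, hv]
end

section
/- Let (Y, σ) be an (n,m)-voltage operator with Y nonempty and fix y₀ ∈ Y. The following are equivalent: (a) for every nonempty n-premaniplex X on which W_n acts transitively, the W_m-action on X ⋊_σ Y is transitive (i.e. (Y, σ) preserves connectivity); (b) the W_m-action on Y is transitive and { σ(w, y₀) : w ∈ W_m, w·y₀ = y₀ } = W_n. -/
/-- A voltage operator `(Y, σ)` preserves connectivity (transitivity)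
iff `Y` is a transitive `W m`-set and the local group `{σ w y₀ : w · y₀ = y₀}` is all
of `W n`. -/
theorem statement4 {n m : ℕ} (Y : Type*) [MulAction (W m) Y]
    (σ : W m → Y → W n) (hσ : IsVoltage (smulF (W m) Y) σ) (y₀ : Y) :
    (∀ (X : Type) [MulAction (W n) X], Nonempty X →
        (∀ x x' : X, ∃ w : W n, w • x = x') →
        ∀ p q : X × Y, ∃ w : W m, vAct (smulF (W n) X) (smulF (W m) Y) σ w p = q) ↔
    ((∀ y y' : Y, ∃ w : W m, w • y = y') ∧
      ∀ g : W n, ∃ w : W m, w • y₀ = y₀ ∧ σ w y₀ = g) := by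
  obtain ⟨-, hmul⟩ := hσ
  simp only [vAct, smulF, Prod.mk.injEq, Prod.forall] at hmul ⊢
  constructor
  · intro h
    have hreg := h (W n) ⟨1⟩ fun x x' => ⟨x' * x⁻¹, by simp⟩
    refine ⟨fun y y' => ?_, fun g => ?_⟩
    · obtain ⟨w, -, hw⟩ := hreg 1 y 1 y'
      exact ⟨w, hw⟩
    · obtain ⟨w, hg, hw⟩ := hreg 1 y₀ g y₀
      exact ⟨w, hw, by simpa using hg⟩
  · rintro ⟨htrans, hloc⟩ X _ - hX x y x' y'
    obtain ⟨a, ha⟩ := htrans y y₀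
    obtain ⟨b, hb⟩ := htrans y₀ y'
    obtain ⟨g, hg⟩ := hX (σ a y • x) ((σ b y₀)⁻¹ • x')
    obtain ⟨w, hw, hwg⟩ := hloc g
    refine ⟨b * (w * a), ?_, ?_⟩
    · rw [hmul, hmul, mul_smul w a, ha, hw, hwg, mul_smul, mul_smul, hg, smul_inv_smul]
    · rw [mul_smul, mul_smul, ha, hw, hb]
end

section
/- Let X be an n-premaniplex, (Y, σ) an (n,m)-voltage operator, and let Γ be a group acting on X on the right by W_n-equivariant bijections (automorphisms of X). Then Γ acts on X ⋊_σ Y on the right by (x, y)·γ = (x·γ, y), this action commutes with the W_m-action, and the map (x, y)·Γ ↦ (x·Γ, y) is a W_m-equivariant bijection from the orbit set (X ⋊_σ Y)/Γ (with its induced W_m-action) to (X/Γ) ⋊_σ Y, where X/Γ is the orbit set of X with its induced W_n-action. -/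
/-- The setoid of orbits of a right action of `Γ` (encoded as a left `Γᵐᵒᵖ`-action). -/
def orbRel (Γ X : Type*) [Group Γ] [MulAction Γᵐᵒᵖ X] : Setoid X where
  r x x' := ∃ γ : Γᵐᵒᵖ, γ • x = x'
  iseqv := by
    refine ⟨fun x => ⟨1, one_smul _ _⟩, ?_, ?_⟩
    · rintro x x' ⟨γ, h⟩
      exact ⟨γ⁻¹, by rw [← h, inv_smul_smul]⟩
    · rintro x x' x'' ⟨γ, h⟩ ⟨δ, h'⟩
      exact ⟨δ * γ, by rw [mul_smul, h, h']⟩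

/-- The setoid of orbits of the right `Γ`-action `(x, y) · γ = (x · γ, y)` on `X × Y`. -/
def orbRelProd (Γ X Y : Type*) [Group Γ] [MulAction Γᵐᵒᵖ X] : Setoid (X × Y) where
  r p q := ∃ γ : Γᵐᵒᵖ, (γ • p.1, p.2) = q
  iseqv := by
    refine ⟨fun p => ⟨1, by simp⟩, ?_, ?_⟩
    · rintro ⟨a, b⟩ ⟨c, d⟩ ⟨γ, h⟩
      refine ⟨γ⁻¹, ?_⟩
      rw [← h]
      simp
    · rintro ⟨a, b⟩ ⟨c, d⟩ ⟨e, f⟩ ⟨γ, h⟩ ⟨δ, h'⟩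
      refine ⟨δ * γ, ?_⟩
      rw [← h', ← h]
      simp [mul_smul]

/-- The induced left `W n`-action on the quotient `X/Γ`. -/
def qSmul {n : ℕ} {Γ X : Type*} [Group Γ] [MulAction (W n) X] [MulAction Γᵐᵒᵖ X]
    [SMulCommClass (W n) Γᵐᵒᵖ X] (w : W n) :
    Quotient (orbRel Γ X) → Quotient (orbRel Γ X) :=
  Quotient.map (fun x => w • x) (by
    rintro a b ⟨γ, h⟩
    exact ⟨γ, by rw [← h]; exact (smul_comm w γ a).symm⟩)

/-- The induced `W m`-action on the quotient `(X ⋊_σ Y)/Γ`. -/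
def qVAct {n m : ℕ} {Γ X Y : Type*} [Group Γ] [MulAction (W n) X] [MulAction (W m) Y]
    [MulAction Γᵐᵒᵖ X] [SMulCommClass (W n) Γᵐᵒᵖ X] (σ : W m → Y → W n) (w : W m) :
    Quotient (orbRelProd Γ X Y) → Quotient (orbRelProd Γ X Y) :=
  Quotient.map (vAct (smulF (W n) X) (smulF (W m) Y) σ w) (by
    rintro ⟨a, b⟩ ⟨c, d⟩ ⟨γ, h⟩
    rw [Prod.mk.injEq] at h
    obtain ⟨h₁, h₂⟩ := h
    subst h₂
    refine ⟨γ, ?_⟩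
    simp only [vAct, smulF]
    rw [Prod.mk.injEq]
    refine ⟨?_, rfl⟩
    rw [← h₁]
    exact (smul_comm (σ w b) γ a).symm)

/-- The map `(x, y) · Γ ↦ (x · Γ, y)` from `(X × Y)/Γ` to `X/Γ × Y`. -/
def orbProdMap (Γ X Y : Type*) [Group Γ] [MulAction Γᵐᵒᵖ X] :
    Quotient (orbRelProd Γ X Y) → Quotient (orbRel Γ X) × Y :=
  Quotient.lift (fun p => (Quotient.mk (orbRel Γ X) p.1, p.2)) (by
    rintro p _ ⟨γ, rfl⟩
    exact Prod.ext (Quotient.sound ⟨γ, rfl⟩) rfl)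

theorem orbProdMap_bijective (Γ X Y : Type*) [Group Γ] [MulAction Γᵐᵒᵖ X] :
    Function.Bijective (orbProdMap Γ X Y) := by
  constructor
  · rintro ⟨x, y⟩ ⟨x', y'⟩ h
    obtain ⟨hx, hy⟩ := Prod.mk.inj h
    obtain ⟨γ, hγ⟩ := Quotient.exact hx
    exact Quotient.sound ⟨γ, Prod.ext hγ hy⟩
  · rintro ⟨⟨x⟩, y⟩
    exact ⟨Quotient.mk _ (x, y), rfl⟩

/-- A group `Γ` of automorphisms of `X` (a right action by
`W n`-equivariant bijections, encoded as a left `Γᵐᵒᵖ`-action commuting with the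
`W n`-action) acts on `X ⋊_σ Y` on the right by `(x, y) · γ = (x · γ, y)`; this action
commutes with the `W m`-action, and `(x, y) · Γ ↦ (x · Γ, y)` is a `W m`-equivariant
bijection `(X ⋊_σ Y)/Γ → (X/Γ) ⋊_σ Y`. -/
theorem statement6 {n m : ℕ} (Γ X Y : Type*) [Group Γ]
    [MulAction (W n) X] [MulAction (W m) Y]
    [MulAction Γᵐᵒᵖ X] [SMulCommClass (W n) Γᵐᵒᵖ X]
    (σ : W m → Y → W n) (hσ : IsVoltage (smulF (W m) Y) σ) :
    ((∀ p : X × Y, (((1 : Γᵐᵒᵖ) • p.1, p.2) : X × Y) = p) ∧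
      (∀ (γ δ : Γᵐᵒᵖ) (p : X × Y),
        (((γ * δ) • p.1, p.2) : X × Y) = (γ • ((δ • p.1, p.2) : X × Y).1, ((δ • p.1, p.2) : X × Y).2)) ∧
      (∀ (γ : Γᵐᵒᵖ) (w : W m) (p : X × Y),
        ((γ • (vAct (smulF (W n) X) (smulF (W m) Y) σ w p).1,
            (vAct (smulF (W n) X) (smulF (W m) Y) σ w p).2) : X × Y) =
          vAct (smulF (W n) X) (smulF (W m) Y) σ w (γ • p.1, p.2))) ∧
    ∃ e : Quotient (orbRelProd Γ X Y) → Quotient (orbRel Γ X) × Y,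
      (∀ p : X × Y, e (Quotient.mk (orbRelProd Γ X Y) p) = (Quotient.mk (orbRel Γ X) p.1, p.2)) ∧
      Function.Bijective e ∧
      ∀ (w : W m) (q : Quotient (orbRelProd Γ X Y)),
        e (qVAct σ w q) =
          vAct (fun (g : W n) (c : Quotient (orbRel Γ X)) => qSmul g c) (smulF (W m) Y) σ w (e q) := by
  refine ⟨⟨fun p => by simp, fun γ δ p => by simp [mul_smul], fun γ w p => ?_⟩,
    orbProdMap Γ X Y, fun _ => rfl, orbProdMap_bijective Γ X Y, ?_⟩
  · exact Prod.ext (smul_comm (σ w p.2) γ p.1).symm rfl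
  · rintro w ⟨p⟩
    rfl
end

section
/- Let X be an n-premaniplex, (Y, σ) an (n,m)-voltage operator, γ : X → X a W_n-equivariant bijection, and (x, y) ∈ X × Y. The induced automorphism γ̄ : (x′, y′) ↦ (γ(x′), y′) of X ⋊_σ Y maps the W_m-orbit of (x, y) onto itself if and only if there exists w ∈ W_m with w·y = y and σ(w, y)·x = γ(x). -/
/-- The induced automorphism `γ̄ : (x', y') ↦ (γ x', y')` of `X ⋊_σ Y`
maps the `W m`-orbit of `(x, y)` onto itself iff there is `w ∈ W m` with `w · y = y`
and `σ w y · x = γ x`. -/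
theorem statement8 {n m : ℕ} (X Y : Type*) [MulAction (W n) X] [MulAction (W m) Y]
    (σ : W m → Y → W n) (hσ : IsVoltage (smulF (W m) Y) σ)
    (γ : X ≃ X) (hγ : ∀ (w : W n) (x : X), γ (w • x) = w • γ x)
    (x : X) (y : Y) :
    (Prod.map γ (id : Y → Y) ''
        {q : X × Y | ∃ w : W m, vAct (smulF (W n) X) (smulF (W m) Y) σ w (x, y) = q} =
      {q : X × Y | ∃ w : W m, vAct (smulF (W n) X) (smulF (W m) Y) σ w (x, y) = q}) ↔
    ∃ w : W m, w • y = y ∧ σ w y • x = γ x := by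
  have key : ∀ w : W m, w • y = y → σ w y • x = γ x → ∀ v : W m,
      Prod.map γ (id : Y → Y) (vAct (smulF (W n) X) (smulF (W m) Y) σ v (x, y)) =
        vAct (smulF (W n) X) (smulF (W m) Y) σ (v * w) (x, y) := by
    intro w hwy hwx v
    have hmul : σ (v * w) y = σ v y * σ w y := by
      rw [hσ.2 v w y, smulF, hwy]
    simp only [vAct, smulF, Prod.map_apply, id_eq, hmul, mul_smul, hwx, hwy, hγ]
  constructor
  · intro h
    have hmem : (γ x, y) ∈ Prod.map γ (id : Y → Y) ''
        {q : X × Y | ∃ w : W m, vAct (smulF (W n) X) (smulF (W m) Y) σ w (x, y) = q} :=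
      ⟨(x, y), ⟨1, by simp [vAct, smulF, hσ.1]⟩, rfl⟩
    rw [h] at hmem
    obtain ⟨w, hw⟩ := hmem
    exact ⟨w, congrArg Prod.snd hw, congrArg Prod.fst hw⟩
  · rintro ⟨w, hwy, hwx⟩
    ext q
    constructor
    · rintro ⟨_, ⟨v, rfl⟩, rfl⟩
      exact ⟨v * w, (key w hwy hwx v).symm⟩
    · rintro ⟨u, rfl⟩
      exact ⟨_, ⟨u * w⁻¹, rfl⟩, by rw [key w hwy hwx, inv_mul_cancel_right]⟩
end

section
/- Let X be an n-premaniplex, (Y, σ) an (n,m)-voltage operator, Γ a group, and ξ : W_n × X → Γ a voltage cocycle on X. Define θ : W_m × (X × Y) → Γ by θ(w, (x, y)) = ξ(σ(w, y), x). Then θ is a voltage cocycle on the m-premaniplex X ⋊_σ Y, and the map ((x, y), γ) ↦ ((x, γ), y) is a W_m-equivariant bijection from the derived premaniplex (X ⋊_σ Y)^θ to the premaniplex X^ξ ⋊_σ Y obtained by applying the voltage operation to the derived premaniplex X^ξ. -/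
/-- Given a voltage cocycle `ξ : W n × X → Γ`, the map
`θ (w, (x, y)) = ξ (σ w y, x)` is a voltage cocycle on `X ⋊_σ Y`, and
`((x, y), γ) ↦ ((x, γ), y)` is a `W m`-equivariant bijection
`(X ⋊_σ Y)^θ → X^ξ ⋊_σ Y`. -/
theorem statement9 {n m : ℕ} (X Y Γ : Type*) [Group Γ]
    [MulAction (W n) X] [MulAction (W m) Y]
    (σ : W m → Y → W n) (ξ : W n → X → Γ)
    (hσ : IsVoltage (smulF (W m) Y) σ)
    (hξ : IsVoltage (smulF (W n) X) ξ) :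
    IsVoltage (vAct (smulF (W n) X) (smulF (W m) Y) σ)
      (fun (w : W m) (p : X × Y) => ξ (σ w p.2) p.1) ∧
    Function.Bijective
      (fun q : (X × Y) × Γ => (((q.1.1, q.2), q.1.2) : (X × Γ) × Y)) ∧
    ∀ (w : W m) (q : (X × Y) × Γ),
      (fun q : (X × Y) × Γ => (((q.1.1, q.2), q.1.2) : (X × Γ) × Y))
          (dAct (vAct (smulF (W n) X) (smulF (W m) Y) σ)
            (fun (w : W m) (p : X × Y) => ξ (σ w p.2) p.1) w q) =
        vAct (dAct (smulF (W n) X) ξ) (smulF (W m) Y) σ w ((q.1.1, q.2), q.1.2) := by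
  refine ⟨⟨fun p => ?_, fun v w p => ?_⟩, ⟨?_, ?_⟩, fun w q => rfl⟩
  · simp only [hσ.1, hξ.1]
  · simp only [vAct, hσ.2, hξ.2]
  · rintro ⟨⟨x, y⟩, γ⟩ ⟨⟨x', y'⟩, γ'⟩ h
    simp only [Prod.mk.injEq] at h ⊢
    tauto
  · rintro ⟨⟨x, γ⟩, y⟩
    exact ⟨((x, y), γ), rfl⟩
end

section
/- Let σ₁ : W_m × Y₁ → W_n be a voltage cocycle on an m-premaniplex Y₁ and σ₂ : W_ℓ × Y₂ → W_m a voltage cocycle on an ℓ-premaniplex Y₂. Define θ : W_ℓ × (Y₁ × Y₂) → W_n by θ(w, (y₁, y₂)) = σ₁(σ₂(w, y₂), y₁). Then θ is a voltage cocycle on the ℓ-premaniplex Y₁ ⋊_{σ₂} Y₂, and for every n-premaniplex X the map ((x, y₁), y₂) ↦ (x, (y₁, y₂)) is a W_ℓ-equivariant bijection from (X ⋊_{σ₁} Y₁) ⋊_{σ₂} Y₂ to X ⋊_θ (Y₁ ⋊_{σ₂} Y₂). In particular, the composition of two voltage operations is a voltage operation. -/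
/-- The composition of two voltage operations is a voltage operation:
`θ (w, (y₁, y₂)) = σ₁ (σ₂ w y₂) y₁` is a voltage cocycle on `Y₁ ⋊_{σ₂} Y₂`, and
`((x, y₁), y₂) ↦ (x, (y₁, y₂))` is a `W l`-equivariant bijection
`(X ⋊_{σ₁} Y₁) ⋊_{σ₂} Y₂ → X ⋊_θ (Y₁ ⋊_{σ₂} Y₂)`. -/
theorem statement11 {n m l : ℕ} (X Y₁ Y₂ : Type*)
    [MulAction (W n) X] [MulAction (W m) Y₁] [MulAction (W l) Y₂]
    (σ₁ : W m → Y₁ → W n) (σ₂ : W l → Y₂ → W m)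
    (h₁ : IsVoltage (smulF (W m) Y₁) σ₁)
    (h₂ : IsVoltage (smulF (W l) Y₂) σ₂) :
    IsVoltage (vAct (smulF (W m) Y₁) (smulF (W l) Y₂) σ₂)
      (fun (w : W l) (p : Y₁ × Y₂) => σ₁ (σ₂ w p.2) p.1) ∧
    Function.Bijective
      (fun q : (X × Y₁) × Y₂ => ((q.1.1, (q.1.2, q.2)) : X × (Y₁ × Y₂))) ∧
    ∀ (w : W l) (q : (X × Y₁) × Y₂),
      (fun q : (X × Y₁) × Y₂ => ((q.1.1, (q.1.2, q.2)) : X × (Y₁ × Y₂)))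
          (vAct (vAct (smulF (W n) X) (smulF (W m) Y₁) σ₁) (smulF (W l) Y₂) σ₂ w q) =
        vAct (smulF (W n) X) (vAct (smulF (W m) Y₁) (smulF (W l) Y₂) σ₂)
          (fun (w : W l) (p : Y₁ × Y₂) => σ₁ (σ₂ w p.2) p.1) w (q.1.1, (q.1.2, q.2)) := by
  refine ⟨⟨fun p => ?_, fun v w p => ?_⟩, ⟨?_, ?_⟩, fun _ _ => rfl⟩
  · simp only [h₂.1, h₁.1]
  · simp only [h₂.2, h₁.2, vAct]
  · rintro ⟨⟨x, y₁⟩, y₂⟩ ⟨⟨x', y₁'⟩, y₂'⟩ h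
    simpa [and_assoc] using h
  · rintro ⟨x, y₁, y₂⟩
    exact ⟨((x, y₁), y₂), rfl⟩
end

section
/- Let Z be an m-premaniplex equipped additionally with a free right action of W_n that commutes with the left W_m-action, and let Y = Z/W_n be the set of right W_n-orbits with its induced left W_m-action. Then there exists a voltage cocycle σ : W_m × Y → W_n and a W_m-equivariant bijection from Z to U ⋊_σ Y, where U = W_n with the left-multiplication action. Consequently, for every subgroup Γ of W_n, the orbit set Z/Γ (under the restricted right action) is W_m-equivariantly bijective to (U/Γ) ⋊_σ Y, where U/Γ is the set of orbits of U under the right Γ-action, with its induced left W_n-action. -/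
/-- The setoid of orbits of the right `W n`-action on `Z`
(encoded as a left `(W n)ᵐᵒᵖ`-action). -/
def fullRel (n : ℕ) (Z : Type*) [MulAction (W n)ᵐᵒᵖ Z] : Setoid Z where
  r z z' := ∃ g : (W n)ᵐᵒᵖ, g • z = z'
  iseqv := by
    refine ⟨fun z => ⟨1, one_smul _ _⟩, ?_, ?_⟩
    · rintro z z' ⟨g, h⟩
      exact ⟨g⁻¹, by rw [← h, inv_smul_smul]⟩
    · rintro z z' z'' ⟨g, h⟩ ⟨g', h'⟩
      exact ⟨g' * g, by rw [mul_smul, h, h']⟩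

/-- The quotient `Y = Z / W n` of right `W n`-orbits. -/
def Yq (n : ℕ) (Z : Type*) [MulAction (W n)ᵐᵒᵖ Z] : Type _ := Quotient (fullRel n Z)

/-- The induced left `W m`-action on `Y = Z / W n`. -/
def yAct {n m : ℕ} {Z : Type*} [MulAction (W m) Z] [MulAction (W n)ᵐᵒᵖ Z]
    [SMulCommClass (W m) (W n)ᵐᵒᵖ Z] (w : W m) : Yq n Z → Yq n Z :=
  Quotient.map (fun z => w • z) (by
    rintro a b ⟨g, h⟩
    exact ⟨g, by rw [← h]; exact (smul_comm w g a).symm⟩)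

/-- The setoid of right cosets of a subgroup `Γ ≤ W n` on `U = W n`. -/
def cosetRel {n : ℕ} (Γ : Subgroup (W n)) : Setoid (W n) where
  r g g' := ∃ γ ∈ Γ, g * γ = g'
  iseqv := by
    refine ⟨fun g => ⟨1, Γ.one_mem, mul_one g⟩, ?_, ?_⟩
    · rintro g g' ⟨γ, hγ, h⟩
      exact ⟨γ⁻¹, Γ.inv_mem hγ, by rw [← h, mul_assoc, mul_inv_cancel, mul_one]⟩
    · rintro g g' g'' ⟨γ, hγ, h⟩ ⟨γ', hγ', h'⟩
      exact ⟨γ * γ', Γ.mul_mem hγ hγ', by rw [← h', ← h, mul_assoc]⟩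

/-- The induced left `W n`-action on `U/Γ`, the set of right `Γ`-orbits of `U = W n`. -/
def uAct {n : ℕ} (Γ : Subgroup (W n)) (w : W n) :
    Quotient (cosetRel Γ) → Quotient (cosetRel Γ) :=
  Quotient.map (fun g => w * g) (by
    rintro a b ⟨γ, hγ, h⟩
    exact ⟨γ, hγ, by rw [← h, mul_assoc]⟩)

/-- The setoid of orbits of the restricted right `Γ`-action on `Z`, for `Γ ≤ W n`. -/
def subRel {n : ℕ} (Γ : Subgroup (W n)) (Z : Type*) [MulAction (W n)ᵐᵒᵖ Z] :
    Setoid Z where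
  r z z' := ∃ γ ∈ Γ, MulOpposite.op γ • z = z'
  iseqv := by
    refine ⟨fun z => ⟨1, Γ.one_mem, by simp⟩, ?_, ?_⟩
    · rintro z z' ⟨γ, hγ, h⟩
      refine ⟨γ⁻¹, Γ.inv_mem hγ, ?_⟩
      rw [← h, ← mul_smul, ← MulOpposite.op_mul]
      simp
    · rintro z z' z'' ⟨γ, hγ, h⟩ ⟨γ', hγ', h'⟩
      refine ⟨γ * γ', Γ.mul_mem hγ hγ', ?_⟩
      rw [← h', ← h, ← mul_smul, ← MulOpposite.op_mul]

/-- The induced left `W m`-action on `Z/Γ`. -/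
def zAct {n m : ℕ} (Γ : Subgroup (W n)) {Z : Type*} [MulAction (W m) Z]
    [MulAction (W n)ᵐᵒᵖ Z] [SMulCommClass (W m) (W n)ᵐᵒᵖ Z] (w : W m) :
    Quotient (subRel Γ Z) → Quotient (subRel Γ Z) :=
  Quotient.map (fun z => w • z) (by
    rintro a b ⟨γ, hγ, h⟩
    exact ⟨γ, hγ, by rw [← h]; exact (smul_comm w (MulOpposite.op γ) a).symm⟩)

section FreeRightAction

variable {n m : ℕ} {Z : Type*} [MulAction (W m) Z] [MulAction (W n)ᵐᵒᵖ Z]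

/-- The right `W n`-orbit of `z`. -/
def orbitMk (n : ℕ) {Z : Type*} [MulAction (W n)ᵐᵒᵖ Z] (z : Z) : Yq n Z :=
  Quotient.mk (fullRel n Z) z

/-- A chosen representative of a right `W n`-orbit. -/
noncomputable def orbitRep (y : Yq n Z) : Z := Quotient.out (s := fullRel n Z) y

theorem orbitMk_orbitRep (y : Yq n Z) : orbitMk n (orbitRep y) = y :=
  Quotient.out_eq (s := fullRel n Z) y

theorem orbitMk_op_smul (g : W n) (z : Z) : orbitMk n (MulOpposite.op g • z) = orbitMk n z :=
  (Quotient.sound (s := fullRel n Z) ⟨MulOpposite.op g, rfl⟩).symm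

theorem exists_op_smul_orbitRep (z : Z) :
    ∃ g : W n, MulOpposite.op g • orbitRep (orbitMk n z) = z := by
  obtain ⟨g, hg⟩ := Quotient.exact (s := fullRel n Z) (orbitMk_orbitRep (orbitMk n z))
  exact ⟨g.unop, hg⟩

/-- An element of `W n` carrying the chosen representative of the orbit of `z` to `z`. -/
noncomputable def orbitCoord (n : ℕ) {Z : Type*} [MulAction (W n)ᵐᵒᵖ Z] (z : Z) : W n :=
  (exists_op_smul_orbitRep z).choose

theorem op_orbitCoord_smul (z : Z) :
    MulOpposite.op (orbitCoord n z) • orbitRep (orbitMk n z) = z :=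
  (exists_op_smul_orbitRep z).choose_spec

theorem eq_of_orbitCoord_eq_of_orbitMk_eq {z z' : Z} (hc : orbitCoord n z = orbitCoord n z')
    (ho : orbitMk n z = orbitMk n z') : z = z' := by
  rw [← op_orbitCoord_smul (n := n) z, hc, ho, op_orbitCoord_smul]

theorem op_smul_injective_of_free (hfree : ∀ (g : (W n)ᵐᵒᵖ) (z : Z), g • z = z → g = 1)
    {g h : W n} {z : Z} (hgh : MulOpposite.op g • z = MulOpposite.op h • z) : g = h := by
  have key := hfree ((MulOpposite.op h)⁻¹ * MulOpposite.op g) z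
    (by rw [mul_smul, hgh, inv_smul_smul])
  exact MulOpposite.op_injective (inv_mul_eq_one.mp key).symm

theorem orbitCoord_op_smul (hfree : ∀ (g : (W n)ᵐᵒᵖ) (z : Z), g • z = z → g = 1)
    (g : W n) (z : Z) : orbitCoord n (MulOpposite.op g • z) = orbitCoord n z * g := by
  apply op_smul_injective_of_free hfree (z := orbitRep (orbitMk n z))
  rw [MulOpposite.op_mul, mul_smul, op_orbitCoord_smul]
  simpa only [orbitMk_op_smul] using op_orbitCoord_smul (n := n) (MulOpposite.op g • z)

theorem orbitCoord_orbitRep (hfree : ∀ (g : (W n)ᵐᵒᵖ) (z : Z), g • z = z → g = 1)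
    (y : Yq n Z) : orbitCoord n (orbitRep y) = 1 := by
  apply op_smul_injective_of_free hfree (z := orbitRep y)
  have h := op_orbitCoord_smul (n := n) (orbitRep y)
  rw [orbitMk_orbitRep] at h
  rw [h, MulOpposite.op_one, one_smul]

/-- The voltage of `w` at the orbit `y`: the coordinate of `w` applied to the representative. -/
noncomputable def orbitVoltage (w : W m) (y : Yq n Z) : W n := orbitCoord n (w • orbitRep y)

variable [SMulCommClass (W m) (W n)ᵐᵒᵖ Z]

theorem yAct_orbitMk (w : W m) (z : Z) : yAct w (orbitMk n z) = orbitMk n (w • z) := rfl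

theorem orbitCoord_smul (hfree : ∀ (g : (W n)ᵐᵒᵖ) (z : Z), g • z = z → g = 1)
    (w : W m) (z : Z) :
    orbitCoord n (w • z) = orbitVoltage w (orbitMk n z) * orbitCoord n z := by
  conv_lhs => rw [← op_orbitCoord_smul (n := n) z, smul_comm, orbitCoord_op_smul hfree]
  rfl

theorem isVoltage_orbitVoltage (hfree : ∀ (g : (W n)ᵐᵒᵖ) (z : Z), g • z = z → g = 1) :
    IsVoltage (fun (w : W m) (y : Yq n Z) => yAct w y) orbitVoltage := by
  refine ⟨fun y => ?_, fun v w y => ?_⟩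
  · rw [orbitVoltage, one_smul, orbitCoord_orbitRep hfree]
  · have h : yAct w y = orbitMk n (w • orbitRep y) := by
      rw [← yAct_orbitMk, orbitMk_orbitRep]
    simp only [h]
    rw [orbitVoltage, mul_smul, orbitCoord_smul hfree]
    rfl

theorem bijective_orbitCoord_orbitMk
    (hfree : ∀ (g : (W n)ᵐᵒᵖ) (z : Z), g • z = z → g = 1) :
    Function.Bijective fun z : Z => (orbitCoord n z, orbitMk n z) := by
  refine ⟨fun z z' h => ?_, fun ⟨g, y⟩ => ⟨MulOpposite.op g • orbitRep y, ?_⟩⟩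
  · exact eq_of_orbitCoord_eq_of_orbitMk_eq (congrArg Prod.fst h) (congrArg Prod.snd h)
  · simp only [orbitCoord_op_smul hfree, orbitCoord_orbitRep hfree, orbitMk_op_smul,
      orbitMk_orbitRep, one_mul]

/-- The map `Z/Γ → U/Γ × Y` induced by the coordinate and orbit maps. -/
noncomputable def subgroupOrbitCoord (hfree : ∀ (g : (W n)ᵐᵒᵖ) (z : Z), g • z = z → g = 1)
    (Γ : Subgroup (W n)) : Quotient (subRel Γ Z) → Quotient (cosetRel Γ) × Yq n Z :=
  Quotient.lift (fun z => (Quotient.mk (cosetRel Γ) (orbitCoord n z), orbitMk n z)) (by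
    rintro z _ ⟨γ, hγ, rfl⟩
    exact Prod.ext (Quotient.sound ⟨γ, hγ, (orbitCoord_op_smul hfree γ z).symm⟩)
      (orbitMk_op_smul γ z).symm)

theorem bijective_subgroupOrbitCoord
    (hfree : ∀ (g : (W n)ᵐᵒᵖ) (z : Z), g • z = z → g = 1) (Γ : Subgroup (W n)) :
    Function.Bijective (subgroupOrbitCoord hfree Γ) := by
  constructor
  · rintro ⟨z⟩ ⟨z'⟩ h
    obtain ⟨γ, hγ, hc⟩ := Quotient.exact (s := cosetRel Γ) (congrArg Prod.fst h)
    have ho : orbitMk n z = orbitMk n z' := congrArg Prod.snd h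
    refine Quotient.sound (s := subRel Γ Z) ⟨γ, hγ, ?_⟩
    exact eq_of_orbitCoord_eq_of_orbitMk_eq ((orbitCoord_op_smul hfree γ z).trans hc)
      ((orbitMk_op_smul γ z).trans ho)
  · rintro ⟨⟨g⟩, y⟩
    obtain ⟨z, hz⟩ := (bijective_orbitCoord_orbitMk hfree).2 (g, y)
    exact ⟨Quotient.mk (subRel Γ Z) z,
      Prod.ext (congrArg (Quotient.mk (cosetRel Γ)) (congrArg Prod.fst hz))
        (congrArg Prod.snd hz :)⟩

end FreeRightAction

/-- If `Z` is an `m`-premaniplex with a free right `W n`-action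
commuting with the left `W m`-action, and `Y = Z / W n`, then there is a voltage
cocycle `σ : W m × Y → W n` and a `W m`-equivariant bijection `Z ≃ U ⋊_σ Y`;
consequently, for every subgroup `Γ ≤ W n` the quotient `Z/Γ` is `W m`-equivariantly
bijective to `(U/Γ) ⋊_σ Y`. -/
theorem statement16 {n m : ℕ} (Z : Type*) [MulAction (W m) Z] [MulAction (W n)ᵐᵒᵖ Z]
    [SMulCommClass (W m) (W n)ᵐᵒᵖ Z]
    (hfree : ∀ (g : (W n)ᵐᵒᵖ) (z : Z), g • z = z → g = 1) :
    ∃ σ : W m → Yq n Z → W n,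
      IsVoltage (fun (w : W m) (q : Yq n Z) => yAct w q) σ ∧
      (∃ e : Z → W n × Yq n Z,
        Function.Bijective e ∧
        ∀ (w : W m) (z : Z),
          e (w • z) =
            vAct (fun (g h : W n) => g * h)
              (fun (w : W m) (q : Yq n Z) => yAct w q) σ w (e z)) ∧
      ∀ Γ : Subgroup (W n),
        ∃ e' : Quotient (subRel Γ Z) → Quotient (cosetRel Γ) × Yq n Z,
          Function.Bijective e' ∧
          ∀ (w : W m) (q : Quotient (subRel Γ Z)),
            e' (zAct Γ w q) =
              vAct (uAct Γ) (fun (w : W m) (q : Yq n Z) => yAct w q) σ w (e' q) := by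
  refine ⟨orbitVoltage, isVoltage_orbitVoltage hfree,
    ⟨_, bijective_orbitCoord_orbitMk hfree, fun w z => ?_⟩,
    fun Γ => ⟨_, bijective_subgroupOrbitCoord hfree Γ, ?_⟩⟩
  · exact Prod.ext (orbitCoord_smul hfree w z) rfl
  · rintro w ⟨z⟩
    exact Prod.ext (congrArg (Quotient.mk (cosetRel Γ)) (orbitCoord_smul hfree w z)) rfl
end
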